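/- Let n > 3, x ∈ ℝⁿ, and α = (α_1, α_2) ∈ ℝ². Suppose the quadratic polynomial t² + α_1 t + α_2 has only real roots −β_1, −β_2 (equivalently α_1 = β_1 + β_2, α_2 = β_1β_2 for some β_1, β_2 ∈ ℝ). Then for every k with 3 ≤ k ≤ n-1, S_{k;2}(x)² ≥ S_{k-1;2}(x) · S_{k+1;2}(x), where S_{j;2}(x) = E_j(x) + α_1 E_{j-1}(x) + α_2 E_{j-2}(x). -/

import Mathlib

/-- The `k`-th elementary symmetric polynomial of a vector `v ∈ ℝ^m`. -/
noncomputable def esymmFin {m : ℕ} (v : Fin m → ℝ) (k : ℕ) : ℝ :=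
  ∑ t ∈ Finset.univ.powersetCard k, ∏ i ∈ t, v i

/-- `σ_k(v)` with integer index: equals `esymmFin v k` for `0 ≤ k` (hence `0` for `k > m`),
and `0` for `k < 0`. -/
noncomputable def sigmaZ {m : ℕ} (v : Fin m → ℝ) (k : ℤ) : ℝ :=
  if 0 ≤ k then esymmFin v k.toNat else 0

/-- The `k`-th elementary symmetric mean `E_k(v) = σ_k(v) / C(m,k)`, integer index. -/
noncomputable def emeanZ {m : ℕ} (v : Fin m → ℝ) (k : ℤ) : ℝ :=
  if 0 ≤ k then esymmFin v k.toNat / (m.choose k.toNat) else 0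

/-- `S_{k;s}(x) = E_k(x) + ∑_{i=1}^s α_i E_{k-i}(x)`. -/
noncomputable def Ssk {n s : ℕ} (x : Fin n → ℝ) (α : Fin s → ℝ) (k : ℤ) : ℝ :=
  emeanZ x k + ∑ i : Fin s, α i * emeanZ x (k - ((i : ℕ) + 1))

/-- `Q_{k;s}(x) = σ_k(x) + ∑_{i=1}^s α_i σ_{k-i}(x)`. -/
noncomputable def Qks {n s : ℕ} (x : Fin n → ℝ) (α : Fin s → ℝ) (k : ℤ) : ℝ :=
  sigmaZ x k + ∑ i : Fin s, α i * sigmaZ x (k - ((i : ℕ) + 1))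

/-- Condition C: `t^s + α_1 t^{s-1} + ⋯ + α_s` has only real roots `-β_1,…,-β_s`;
equivalently `α_i = e_i(β)` for some `β ∈ ℝ^s`. -/
def ConditionC {s : ℕ} (α : Fin s → ℝ) : Prop :=
  ∃ β : Fin s → ℝ, ∀ i : Fin s, α i = esymmFin β ((i : ℕ) + 1)

section

open Polynomial

/-- The derivative of a real-rooted polynomial is real-rooted. -/
theorem Polynomial.Splits.derivative_real {p : ℝ[X]} (hp : p.Splits) :
    (derivative p).Splits := by
  rw [splits_iff_card_roots]
  have h₁ := card_roots_le_derivative p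
  have h₂ := card_roots' (derivative p)
  have h₃ := natDegree_derivative_le p
  rw [splits_iff_card_roots.mp hp] at h₁
  omega

theorem Polynomial.Splits.reverse_of_field {K : Type*} [Field K] {p : K[X]} (hp : p.Splits) :
    p.reverse.Splits := by
  induction hp using Submonoid.closure_induction with
  | mem q hq =>
    rcases hq with ⟨a, rfl⟩ | ⟨a, rfl⟩
    · simp
    · exact Splits.of_natDegree_le_one
        ((reverse_natDegree_le _).trans (natDegree_X_add_C a).le)
  | one =>
    rw [← C_1, reverse_C]
    exact Splits.C 1
  | mul q r _ _ hq hr =>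
    rw [reverse_mul_of_domain]
    exact hq.mul hr

theorem Polynomial.Splits.reflect_of_field {K : Type*} [Field K] {p : K[X]} (hp : p.Splits)
    {n : ℕ} (hn : p.natDegree ≤ n) : (p.reflect n).Splits := by
  have h := reflect_mul p 1 (le_refl p.natDegree)
    (natDegree_one.le.trans (Nat.zero_le (n - p.natDegree)))
  rw [mul_one, Nat.add_sub_cancel' hn, reflect_one] at h
  rw [h]
  exact hp.reverse_of_field.mul (Splits.X_pow _)

theorem Polynomial.reflect_derivative_reflect {R : Type*} [CommRing R] {p : R[X]} {n : ℕ}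
    (hn : p.natDegree ≤ n + 1) :
    (derivative (p.reflect (n + 1))).reflect n
      = C ((n : R) + 1) * p - X * derivative p := by
  ext i
  rw [coeff_reflect, coeff_derivative, coeff_reflect, coeff_sub, coeff_C_mul]
  have hX : (X * derivative p).coeff i = p.coeff i * i := by
    cases i with
    | zero => simp
    | succ j => rw [coeff_X_mul, coeff_derivative]; push_cast; ring
  rw [hX]
  rcases le_or_gt i n with hi | hi
  · rw [revAt_le hi, revAt_le (by omega), show n + 1 - (n - i + 1) = i by omega]
    push_cast [hi]
    ring
  · rw [revAt_eq_self_of_lt hi]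
    rcases eq_or_lt_of_le (Nat.succ_le_of_lt hi) with h | h
    · subst h
      rw [revAt_eq_self_of_lt (by omega), coeff_eq_zero_of_natDegree_lt (by omega)]
      push_cast
      ring
    · rw [revAt_eq_self_of_lt (by omega), coeff_eq_zero_of_natDegree_lt (by omega),
        coeff_eq_zero_of_natDegree_lt (by omega)]
      ring

/-- Polar derivatives (with pole at the origin) preserve real-rootedness. -/
theorem Polynomial.Splits.polar_derivative_real {p : ℝ[X]} (hp : p.Splits) {n : ℕ}
    (hn : p.natDegree ≤ n + 1) :
    (C ((n : ℝ) + 1) * p - X * derivative p).Splits := by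
  rw [← reflect_derivative_reflect hn]
  refine (hp.reflect_of_field hn).derivative_real.reflect_of_field ?_
  have h₁ := natDegree_derivative_le (p.reflect (n + 1))
  have h₂ := natDegree_reflect_le (N := n + 1) (p := p)
  rw [max_eq_left hn] at h₂
  omega

/-- Polar derivatives with an arbitrary pole preserve real-rootedness. -/
theorem Polynomial.Splits.derivative_add_polar_real {p : ℝ[X]} (hp : p.Splits) {n : ℕ}
    (hn : p.natDegree ≤ n + 1) (b : ℝ) :
    (derivative p + C b * (C ((n : ℝ) + 1) * p - X * derivative p)).Splits := by
  rcases eq_or_ne b 0 with rfl | hb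
  · simpa using hp.derivative_real
  · have hq := ((hp.comp_X_add_C b⁻¹).polar_derivative_real (n := n)
      (by rwa [natDegree_comp, natDegree_X_add_C, mul_one])).comp_X_sub_C b⁻¹
    refine (congrArg Splits ?_).mp (hq.C_mul b)
    have hc : (X + C b⁻¹ : ℝ[X]).comp (X - C b⁻¹) = X := by simp
    have hbb : C b * C b⁻¹ = (1 : ℝ[X]) := by rw [← C_mul, mul_inv_cancel₀ hb, C_1]
    simp only [sub_comp, mul_comp, C_comp, X_comp, derivative_comp, comp_assoc, hc, comp_X,
      derivative_add, derivative_X, derivative_C, add_zero, one_mul]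
    linear_combination derivative p * hbb

/-- The polynomial `∑_{i ≤ n} C(n,i) c_i X^i` attached to a sequence `c`. -/
noncomputable def binomialPoly (n : ℕ) (c : ℕ → ℝ) : Polynomial ℝ :=
  ∑ i ∈ Finset.range (n + 1), Polynomial.monomial i ((n.choose i : ℝ) * c i)

theorem coeff_binomialPoly (n : ℕ) (c : ℕ → ℝ) (i : ℕ) :
    (binomialPoly n c).coeff i = n.choose i * c i := by
  simp only [binomialPoly, finsetSum_coeff, coeff_monomial, Finset.sum_ite_eq', Finset.mem_range]
  split_ifs with h
  · rfl
  · rw [Nat.choose_eq_zero_of_lt (by omega)]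
    simp

theorem natDegree_binomialPoly_le (n : ℕ) (c : ℕ → ℝ) : (binomialPoly n c).natDegree ≤ n := by
  rw [natDegree_le_iff_coeff_eq_zero]
  intro i hi
  rw [coeff_binomialPoly, Nat.choose_eq_zero_of_lt hi]
  simp

theorem derivative_binomialPoly (n : ℕ) (c : ℕ → ℝ) :
    derivative (binomialPoly (n + 1) c)
      = C ((n : ℝ) + 1) * binomialPoly n (fun i => c (i + 1)) := by
  ext i
  rw [coeff_derivative, coeff_C_mul, coeff_binomialPoly, coeff_binomialPoly]
  have h : ((n : ℝ) + 1) * n.choose i = (n + 1).choose (i + 1) * ((i : ℝ) + 1) := by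
    exact_mod_cast Nat.add_one_mul_choose_eq n i
  linear_combination (-c (i + 1)) * h

theorem polar_derivative_binomialPoly (n : ℕ) (c : ℕ → ℝ) :
    C ((n : ℝ) + 1) * binomialPoly (n + 1) c - X * derivative (binomialPoly (n + 1) c)
      = C ((n : ℝ) + 1) * binomialPoly n c := by
  rw [derivative_binomialPoly]
  ext i
  cases i with
  | zero => simp [coeff_binomialPoly]
  | succ j =>
    rw [coeff_sub, coeff_X_mul]
    simp only [coeff_C_mul, coeff_binomialPoly]
    rw [Nat.choose_succ_succ n j]
    push_cast
    ring

theorem Polynomial.Splits.of_C_mul {K : Type*} [Field K] {p : K[X]} {a : K} (ha : a ≠ 0)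
    (h : (C a * p).Splits) : p.Splits := by
  have := h.C_mul a⁻¹
  rwa [← mul_assoc, ← C_mul, inv_mul_cancel₀ ha, C_1, one_mul] at this

theorem binomialPoly_splits_truncate {n : ℕ} {c : ℕ → ℝ} (h : (binomialPoly (n + 1) c).Splits) :
    (binomialPoly n c).Splits := by
  refine Splits.of_C_mul (a := (n : ℝ) + 1) (by positivity) ?_
  rw [← polar_derivative_binomialPoly]
  exact h.polar_derivative_real (natDegree_binomialPoly_le _ _)

theorem binomialPoly_splits_combine {n : ℕ} {c : ℕ → ℝ} (h : (binomialPoly (n + 1) c).Splits)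
    (b : ℝ) : (binomialPoly n (fun i => c (i + 1) + b * c i)).Splits := by
  refine Splits.of_C_mul (a := (n : ℝ) + 1) (by positivity) ?_
  have hs := h.derivative_add_polar_real (natDegree_binomialPoly_le _ _) b
  rw [polar_derivative_binomialPoly, derivative_binomialPoly] at hs
  refine (congrArg Splits ?_).mp hs
  ext i
  simp only [coeff_add, coeff_C_mul, coeff_binomialPoly]
  ring

theorem binomialPoly_splits_truncate_add {n : ℕ} {c : ℕ → ℝ} (m : ℕ)
    (h : (binomialPoly (n + m) c).Splits) : (binomialPoly n c).Splits := by
  induction m with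
  | zero => exact h
  | succ m ih => exact ih (binomialPoly_splits_truncate h)

theorem binomialPoly_splits_shift {n : ℕ} {c : ℕ → ℝ} (m : ℕ)
    (h : (binomialPoly (n + m) c).Splits) : (binomialPoly n (fun i => c (i + m))).Splits := by
  induction m generalizing c with
  | zero => exact h
  | succ m ih =>
    have := ih (c := fun i => c (i + 1)) (by simpa using binomialPoly_splits_combine h 0)
    simpa only [add_assoc] using this

theorem mul_le_sq_of_binomialPoly_two_splits {c : ℕ → ℝ} (h : (binomialPoly 2 c).Splits) :
    c 0 * c 2 ≤ c 1 ^ 2 := by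
  rcases eq_or_ne (c 2) 0 with h₂ | h₂
  · rw [h₂, mul_zero]
    positivity
  · have hdeg : (binomialPoly 2 c).degree ≠ 0 := by
      intro h₀
      have h₁ : (binomialPoly 2 c).coeff 2 = 0 := coeff_eq_zero_of_degree_lt (by rw [h₀]; decide)
      rw [coeff_binomialPoly] at h₁
      simp [h₂] at h₁
    obtain ⟨r, hr⟩ := h.exists_eval_eq_zero hdeg
    simp [binomialPoly, Finset.sum_range_succ, eval_monomial] at hr
    nlinarith [sq_nonneg (c 2 * r + c 1), congrArg (c 2 * ·) hr]

theorem binomialPoly_emeanZ_splits {n : ℕ} (x : Fin n → ℝ) :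
    (binomialPoly n (fun i => emeanZ x (i : ℤ))).Splits := by
  have h : binomialPoly n (fun i => emeanZ x (i : ℤ)) = ∏ i, (1 + C (x i) * X) := by
    rw [Finset.prod_one_add, Finset.sum_powerset, Finset.card_univ, Fintype.card_fin, binomialPoly]
    refine Finset.sum_congr rfl fun k hk => ?_
    have hc : (n.choose k : ℝ) ≠ 0 := by
      exact_mod_cast (Nat.choose_pos (by simpa [Nat.lt_succ_iff] using hk)).ne'
    simp only [emeanZ, Int.natCast_nonneg, if_true, Int.toNat_natCast]
    rw [mul_div_cancel₀ _ hc, esymmFin, map_sum]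
    refine Finset.sum_congr rfl fun t ht => ?_
    rw [Finset.prod_mul_distrib, Finset.prod_const, (Finset.mem_powersetCard.mp ht).2,
      ← map_prod, C_mul_X_pow_eq_monomial]
  rw [h]
  refine Splits.prod fun i _ => Splits.of_natDegree_le_one ?_
  compute_degree

end

/-- Newton-type inequality for `S_{k;2}` (the case `s = 2`, Theorem 1 of [HRW]):
if `t² + α₁ t + α₂` has only real roots, then
`S_{k;2}(x)² ≥ S_{k-1;2}(x) S_{k+1;2}(x)` for `3 ≤ k ≤ n-1`. -/
theorem newton_inequality_Sk2 (n : ℕ) (hn : 3 < n) (x : Fin n → ℝ) (α₁ α₂ : ℝ)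
    (hC : ∃ β₁ β₂ : ℝ, α₁ = β₁ + β₂ ∧ α₂ = β₁ * β₂) :
    ∀ k : ℤ, 3 ≤ k → k ≤ (n : ℤ) - 1 →
      (emeanZ x (k - 1) + α₁ * emeanZ x (k - 2) + α₂ * emeanZ x (k - 3))
        * (emeanZ x (k + 1) + α₁ * emeanZ x k + α₂ * emeanZ x (k - 1))
      ≤ (emeanZ x k + α₁ * emeanZ x (k - 1) + α₂ * emeanZ x (k - 2)) ^ 2 := by
  obtain ⟨β₁, β₂, rfl, rfl⟩ := hC
  intro k hk hkn
  obtain ⟨m, rfl⟩ : ∃ m : ℕ, k = m + 3 := ⟨(k - 3).toNat, by omega⟩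
  obtain ⟨l, rfl⟩ : ∃ l : ℕ, n = 4 + l + m := ⟨n - 4 - m, by omega⟩
  have h₄ := binomialPoly_splits_truncate_add l
    (binomialPoly_splits_shift m (binomialPoly_emeanZ_splits x))
  have h := mul_le_sq_of_binomialPoly_two_splits
    (binomialPoly_splits_combine (binomialPoly_splits_combine h₄ β₁) β₂)
  push_cast at h
  ring_nf at h ⊢
  exact h
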